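/- The image of M₁·M₃ in PGL₄(ℂ) has order exactly 6: namely, (M₁·M₃)⁶ is a scalar multiple of the identity matrix, and for every n ∈ {1,2,3,4,5}, (M₁·M₃)ⁿ is not a scalar multiple of the identity matrix. -/

import Mathlib

open Matrix Complex

noncomputable def zeta6 : ℂ := (1 + Real.sqrt 3 * Complex.I) / 2
noncomputable def zeta3 : ℂ := (-1 + Real.sqrt 3 * Complex.I) / 2

noncomputable def M1 : Matrix (Fin 4) (Fin 4) ℂ :=
  !![1, 0, 0, 0; 0, 1, 0, 0; 0, 0, 1, 0; 0, 0, 0, zeta3]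

noncomputable def M2 : Matrix (Fin 4) (Fin 4) ℂ :=
  !![1, 0, 0, 0; 0, 1, 0, 0;
     0, 0, (2 * zeta6 - 1) / 3, (-zeta6 - 1) / 3;
     0, 0, (4 * zeta6 - 2) / 3, (zeta6 + 1) / 3]

noncomputable def M3 : Matrix (Fin 4) (Fin 4) ℂ :=
  !![1, 0, 0, 0; 0, 1, 0, 0;
     0, 0, (2 * zeta6 - 1) / 3, (-zeta6 + 2) / 3;
     0, 0, (-2 * zeta6 + 4) / 3, (zeta6 + 1) / 3]

noncomputable def M4 : Matrix (Fin 4) (Fin 4) ℂ :=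
  !![1, 0, 0, 0; 0, 1, 0, 0;
     0, 0, (2 * zeta6 - 1) / 3, (2 * zeta6 - 1) / 3;
     0, 0, (-2 * zeta6 - 2) / 3, (zeta6 + 1) / 3]

noncomputable def M5 : Matrix (Fin 4) (Fin 4) ℂ :=
  !![1, 0, 0, 0; 0, zeta3, 0, 0; 0, 0, 1, 0; 0, 0, 0, 1]

noncomputable def M6 : Matrix (Fin 4) (Fin 4) ℂ :=
  !![(2 * zeta6 - 1) / 3, (-zeta6 - 1) / 3, 0, 0;
     (4 * zeta6 - 2) / 3, (zeta6 + 1) / 3, 0, 0;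
     0, 0, 1, 0; 0, 0, 0, 1]

noncomputable def M7 : Matrix (Fin 4) (Fin 4) ℂ :=
  !![(2 * zeta6 - 1) / 3, (-zeta6 + 2) / 3, 0, 0;
     (-2 * zeta6 + 4) / 3, (zeta6 + 1) / 3, 0, 0;
     0, 0, 1, 0; 0, 0, 0, 1]

noncomputable def M8 : Matrix (Fin 4) (Fin 4) ℂ :=
  !![(2 * zeta6 - 1) / 3, (2 * zeta6 - 1) / 3, 0, 0;
     (-2 * zeta6 - 2) / 3, (zeta6 + 1) / 3, 0, 0;
     0, 0, 1, 0; 0, 0, 0, 1]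

theorem zeta6_sq : zeta6 ^ 2 = zeta6 - 1 := by
  have h : ((Real.sqrt 3 : ℝ) : ℂ) ^ 2 = 3 := by
    rw [← Complex.ofReal_pow, Real.sq_sqrt (by norm_num)]
    norm_num
  unfold zeta6
  linear_combination (1 / 4 : ℂ) * Complex.I ^ 2 * h + (3 / 4 : ℂ) * Complex.I_sq

theorem zeta3_eq_zeta6_sub_one : zeta3 = zeta6 - 1 := by
  unfold zeta3 zeta6
  ring

theorem two_sub_zeta6_ne_zero : 2 - zeta6 ≠ 0 := by
  intro h
  have h3 : (3 : ℂ) = 0 := by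
    linear_combination zeta6_sq + (zeta6 + 1) * h
  norm_num at h3

theorem M1_mul_M3_eq : M1 * M3 =
    !![1, 0, 0, 0; 0, 1, 0, 0;
       0, 0, (2 * zeta6 - 1) / 3, (2 - zeta6) / 3;
       0, 0, (4 * zeta6 - 2) / 3, (zeta6 - 2) / 3] := by
  have h := zeta6_sq
  rw [M1, M3, zeta3_eq_zeta6_sub_one]
  ext i j
  fin_cases i <;> fin_cases j <;> simp [Matrix.mul_apply, Fin.sum_univ_four]
  · ring
  · linear_combination (-2 / 3 : ℂ) * h
  · linear_combination (1 / 3 : ℂ) * h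

theorem M1_mul_M3_sq : (M1 * M3) ^ 2 =
    !![1, 0, 0, 0; 0, 1, 0, 0;
       0, 0, (zeta6 - 1) * ((2 * zeta6 - 1) / 3 - (zeta6 - 1)), (zeta6 - 1) * ((2 - zeta6) / 3);
       0, 0, (zeta6 - 1) * ((4 * zeta6 - 2) / 3),
         (zeta6 - 1) * ((zeta6 - 2) / 3 - (zeta6 - 1))] := by
  have h := zeta6_sq
  rw [M1_mul_M3_eq, pow_two]
  ext i j
  fin_cases i <;> fin_cases j <;> simp [Matrix.mul_apply, Fin.sum_univ_four] <;> grind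

/-- The cube of `M1 * M3` acts as `-1` on the last two coordinates. -/
theorem M1_mul_M3_pow_three : (M1 * M3) ^ 3 =
    !![1, 0, 0, 0; 0, 1, 0, 0; 0, 0, -1, 0; 0, 0, 0, -1] := by
  have h := zeta6_sq
  rw [pow_succ, M1_mul_M3_sq, M1_mul_M3_eq]
  ext i j
  fin_cases i <;> fin_cases j <;> simp [Matrix.mul_apply, Fin.sum_univ_four] <;> grind

theorem M1_mul_M3_pow_six : (M1 * M3) ^ 6 = 1 := by
  rw [show 6 = 3 + 3 from rfl, pow_add, M1_mul_M3_pow_three]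
  ext i j
  fin_cases i <;> fin_cases j <;> simp [Matrix.mul_apply, Fin.sum_univ_four]

theorem M1_mul_M3_pow_three_ne_smul_one (c : ℂ) : (M1 * M3) ^ 3 ≠ c • 1 := by
  rw [M1_mul_M3_pow_three]
  intro h
  have h0 : 1 = c := by simpa using congrFun (congrFun h 0) 0
  have h2 : -1 = c := by simpa using congrFun (congrFun h 2) 2
  rw [← h0] at h2
  norm_num at h2

theorem M1_mul_M3_pow_four_ne_smul_one (c : ℂ) : (M1 * M3) ^ 4 ≠ c • 1 := by
  rw [pow_succ, M1_mul_M3_pow_three, M1_mul_M3_eq]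
  intro h
  have h23 := congrFun (congrFun h 2) 3
  simp [Matrix.mul_apply, Fin.sum_univ_four] at h23
  exact two_sub_zeta6_ne_zero h23

theorem M1_mul_M3_order_six_in_PGL :
    (∃ c : ℂ, (M1 * M3) ^ 6 = c • (1 : Matrix (Fin 4) (Fin 4) ℂ)) ∧
    (∀ n ∈ ({1, 2, 3, 4, 5} : Finset ℕ),
      ¬∃ c : ℂ, (M1 * M3) ^ n = c • (1 : Matrix (Fin 4) (Fin 4) ℂ)) := by
  refine ⟨⟨1, by rw [M1_mul_M3_pow_six, one_smul]⟩, ?_⟩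
  rintro n hn ⟨c, hc⟩
  simp only [Finset.mem_insert, Finset.mem_singleton] at hn
  rcases hn with rfl | rfl | rfl | rfl | rfl
  · refine M1_mul_M3_pow_four_ne_smul_one (c ^ 4) ?_
    rw [← pow_one (M1 * M3), hc, smul_pow, one_pow]
  · refine M1_mul_M3_pow_four_ne_smul_one (c ^ 2) ?_
    rw [pow_mul (M1 * M3) 2 2, hc, smul_pow, one_pow]
  · exact M1_mul_M3_pow_three_ne_smul_one c hc
  · exact M1_mul_M3_pow_four_ne_smul_one c hc
  · refine M1_mul_M3_pow_four_ne_smul_one (c ^ 2) ?_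
    rw [← one_mul ((M1 * M3) ^ 4), ← M1_mul_M3_pow_six, ← pow_add,
      pow_mul (M1 * M3) 5 2, hc, smul_pow, one_pow, M1_mul_M3_pow_six]
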